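/- arXiv:1708.00485 — 2 statements merged into one kernel-verified Lean document; each statement's English description precedes it below -/
import Mathlib

section
/- Let d ∈ {2,3} and let Ω ⊂ ℝ^d be a bounded open set. There exists a constant C₃ = C₃(Ω) such that for every continuously differentiable vector field u : ℝ^d → ℝ^d and all continuously differentiable scalar functions T, S : ℝ^d → ℝ, all with compact support contained in Ω, |b*(u,T,S)| ≤ C₃ ‖∇u‖ ‖∇T‖ ‖∇S‖. -/
open MeasureTheory

noncomputable section

/-- Partial derivative `∂_j f_i` at `x` of a vector field `f : ℝ^d → ℝ^d`. -/
def pd {d : ℕ} (f : (Fin d → ℝ) → (Fin d → ℝ)) (x : Fin d → ℝ) (j i : Fin d) : ℝ :=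
  fderiv ℝ f x (Pi.single j (1 : ℝ)) i

/-- Partial derivative `∂_j f` at `x` of a scalar function `f : ℝ^d → ℝ`. -/
def pdS {d : ℕ} (f : (Fin d → ℝ) → ℝ) (x : Fin d → ℝ) (j : Fin d) : ℝ :=
  fderiv ℝ f x (Pi.single j (1 : ℝ))

/-- Convective term `(u·∇v)_i` at `x`. -/
def conv {d : ℕ} (u v : (Fin d → ℝ) → (Fin d → ℝ)) (x : Fin d → ℝ) (i : Fin d) : ℝ :=
  ∑ j, u x j * pd v x j i

/-- Convective term `u·∇T` at `x` for a scalar `T`. -/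
def convS {d : ℕ} (u : (Fin d → ℝ) → (Fin d → ℝ)) (T : (Fin d → ℝ) → ℝ)
    (x : Fin d → ℝ) : ℝ :=
  ∑ j, u x j * pdS T x j

/-- Divergence `∇·u` at `x`. -/
def divg {d : ℕ} (u : (Fin d → ℝ) → (Fin d → ℝ)) (x : Fin d → ℝ) : ℝ :=
  ∑ j, pd u x j j

/-- Euclidean dot product on `ℝ^d`. -/
def dotv {d : ℕ} (a b : Fin d → ℝ) : ℝ := ∑ i, a i * b i

/-- `L²` norm of a vector field. -/
def l2norm {d : ℕ} (f : (Fin d → ℝ) → (Fin d → ℝ)) : ℝ :=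
  (∫ x, ∑ i, (f x i) ^ 2) ^ (1 / 2 : ℝ)

/-- `L²` norm of the Jacobian matrix of a vector field. -/
def gradNorm {d : ℕ} (f : (Fin d → ℝ) → (Fin d → ℝ)) : ℝ :=
  (∫ x, ∑ i, ∑ j, (pd f x j i) ^ 2) ^ (1 / 2 : ℝ)

/-- `L²` norm of a scalar function. -/
def l2normS {d : ℕ} (f : (Fin d → ℝ) → ℝ) : ℝ :=
  (∫ x, (f x) ^ 2) ^ (1 / 2 : ℝ)

/-- `L²` norm of the gradient of a scalar function. -/
def gradNormS {d : ℕ} (f : (Fin d → ℝ) → ℝ) : ℝ :=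
  (∫ x, ∑ j, (pdS f x j) ^ 2) ^ (1 / 2 : ℝ)

/-- `L^p` norm of a scalar function. -/
def lpnormS {d : ℕ} (p : ℝ) (f : (Fin d → ℝ) → ℝ) : ℝ :=
  (∫ x, |f x| ^ p) ^ (1 / p)

/-- The explicitly skew-symmetric trilinear form
`b(u,v,w) = ½(u·∇v, w) − ½(u·∇w, v)`. -/
def bform {d : ℕ} (u v w : (Fin d → ℝ) → (Fin d → ℝ)) : ℝ :=
  (1 / 2) * (∫ x, dotv (conv u v x) (w x)) - (1 / 2) * (∫ x, dotv (conv u w x) (v x))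

/-- The explicitly skew-symmetric trilinear form
`b*(u,T,S) = ½(u·∇T, S) − ½(u·∇S, T)`. -/
def bstar {d : ℕ} (u : (Fin d → ℝ) → (Fin d → ℝ)) (T S : (Fin d → ℝ) → ℝ) : ℝ :=
  (1 / 2) * (∫ x, convS u T x * S x) - (1 / 2) * (∫ x, convS u S x * T x)

theorem aux_opnorm {d : ℕ} {F : Type*} [NormedAddCommGroup F] [NormedSpace ℝ F]
    (L : (Fin d → ℝ) →L[ℝ] F) :
    ‖L‖ ^ 2 ≤ d * ∑ j, ‖L (Pi.single j (1 : ℝ))‖ ^ 2 := by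
  have h1 : ‖L‖ ≤ ∑ j, ‖L (Pi.single j (1 : ℝ))‖ := by
    refine L.opNorm_le_bound (by positivity) fun v => ?_
    have hv : L v = ∑ j, v j • L (Pi.single j (1 : ℝ)) := by
      conv_lhs => rw [pi_eq_sum_univ' v]
      simp [map_sum, map_smul, Pi.single_apply, funext_iff, Pi.single, Function.update_apply,
        eq_comm]
    rw [hv, Finset.sum_mul]
    refine (norm_sum_le _ _).trans (Finset.sum_le_sum fun j _ => ?_)
    rw [norm_smul, mul_comm]
    gcongr
    exact norm_le_pi_norm v j
  calc ‖L‖ ^ 2 ≤ (∑ j, ‖L (Pi.single j (1 : ℝ))‖) ^ 2 := by gcongr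
    _ ≤ _ := by
      have := sq_sum_le_card_mul_sum_sq (s := (Finset.univ : Finset (Fin d)))
        (f := fun j => ‖L (Pi.single j (1 : ℝ))‖)
      simpa using this

theorem aux_L2 {d : ℕ} {F : Type*} [NormedAddCommGroup F]
    (G : (Fin d → ℝ) → F) (g : (Fin d → ℝ) → ℝ) (K : ℝ) (hK : 0 ≤ K)
    (hg0 : ∀ x, 0 ≤ g x) (hg : Integrable g) (h : ∀ x, ‖G x‖ ^ 2 ≤ K * g x) :
    eLpNorm G 2 volume ≤ ENNReal.ofReal (K ^ (1 / 2 : ℝ) * (∫ x, g x) ^ (1 / 2 : ℝ)) := by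
  have hI : 0 ≤ ∫ x, g x := integral_nonneg hg0
  rw [eLpNorm_eq_lintegral_rpow_enorm_toReal (by norm_num) (by norm_num),
    ← Real.mul_rpow hK hI, ← ENNReal.ofReal_rpow_of_nonneg (by positivity) (by norm_num)]
  simp only [ENNReal.toReal_ofNat]
  gcongr
  rw [← integral_const_mul, ofReal_integral_eq_lintegral_ofReal (hg.const_mul K)
    (Filter.Eventually.of_forall fun x => mul_nonneg hK (hg0 x))]
  gcongr with x
  rw [← ofReal_norm_eq_enorm, ENNReal.ofReal_rpow_of_nonneg (norm_nonneg _) (by norm_num)]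
  apply ENNReal.ofReal_le_ofReal
  simpa using h x

theorem aux_L4 {d : ℕ} (hd : d = 2 ∨ d = 3)
    (Ω : Set (Fin d → ℝ)) (hΩb : Bornology.IsBounded Ω)
    (F : Type*) [NormedAddCommGroup F] [NormedSpace ℝ F] [FiniteDimensional ℝ F] :
    ∃ C : NNReal, ∀ f : (Fin d → ℝ) → F, ContDiff ℝ 1 f → tsupport f ⊆ Ω →
      eLpNorm f 4 volume ≤ C * eLpNorm (fderiv ℝ f) 2 volume := by
  rcases hd with rfl | rfl
  · refine ⟨eLpNormLESNormFDerivOfLeConst F volume Ω (4/3) 4 *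
      ((volume Ω) ^ (1 / 4 : ℝ)).toNNReal, fun f hf hs => ?_⟩
    have h1 := eLpNorm_le_eLpNorm_fderiv_of_le (F := F) (volume : Measure (Fin 2 → ℝ)) hf
      ((subset_tsupport f).trans hs) (p := 4/3) (q := 4)
      (by rw [← NNReal.coe_le_coe]; push_cast; norm_num)
      (by rw [← NNReal.coe_lt_coe]; simp; norm_num) (by simp; norm_num) hΩb
    have hsup : Function.support (fderiv ℝ f) ⊆ Ω :=
      (support_fderiv_subset ℝ).trans hs
    have h2 : eLpNorm (fderiv ℝ f) ((4/3 : NNReal) : ENNReal) volume ≤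
        eLpNorm (fderiv ℝ f) 2 volume * (volume Ω) ^ (1 / 4 : ℝ) := by
      have e : ∀ p : ENNReal, eLpNorm (fderiv ℝ f) p (volume.restrict Ω) =
          eLpNorm (fderiv ℝ f) p volume := fun p =>
        eLpNorm_restrict_eq_of_support_subset (f := fderiv ℝ f) (by exact hsup)
      rw [← e, ← e 2]
      have := eLpNorm_le_eLpNorm_mul_rpow_measure_univ (μ := volume.restrict Ω)
        (f := fderiv ℝ f) (p := ((4/3 : NNReal) : ENNReal)) (q := 2)
        (by
          have : ((4/3 : NNReal)) ≤ 2 := by rw [← NNReal.coe_le_coe]; push_cast; norm_num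
          exact_mod_cast this)
        (hf.continuous_fderiv one_ne_zero).aestronglyMeasurable
      convert this using 2
      rw [Measure.restrict_apply_univ]
      congr 1
      simp
      norm_num
    have hfin : (volume Ω) ^ (1 / 4 : ℝ) ≠ ⊤ :=
      ENNReal.rpow_ne_top_of_nonneg (by norm_num) hΩb.measure_lt_top.ne
    rw [ENNReal.coe_mul, ENNReal.coe_toNNReal hfin]
    calc eLpNorm f 4 volume ≤ _ := h1
      _ ≤ _ := mul_le_mul_right h2 _
      _ = _ := by ring
  · refine ⟨eLpNormLESNormFDerivOfLeConst F volume Ω 2 4, fun f hf hs => ?_⟩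
    have h1 := eLpNorm_le_eLpNorm_fderiv_of_le (F := F) (volume : Measure (Fin 3 → ℝ)) hf
      ((subset_tsupport f).trans hs) (p := 2) (q := 4)
      (by rw [← NNReal.coe_le_coe]; push_cast; norm_num)
      (by rw [← NNReal.coe_lt_coe]; simp; norm_num) (by simp; norm_num) hΩb
    exact h1

theorem aux_gradS {d : ℕ} (T : (Fin d → ℝ) → ℝ) (hT : ContDiff ℝ 1 T)
    (hc : HasCompactSupport T) :
    eLpNorm (fderiv ℝ T) 2 volume ≤ ENNReal.ofReal ((d : ℝ) ^ (1 / 2 : ℝ) * gradNormS T) := by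
  have hcont := hT.continuous_fderiv one_ne_zero
  refine aux_L2 _ (fun x => ∑ j, (pdS T x j) ^ 2) d (by positivity)
    (fun x => by positivity) ?_ fun x => ?_
  · apply Continuous.integrable_of_hasCompactSupport
    · unfold pdS; fun_prop
    · refine (hc.fderiv ℝ).mono fun x hx => ?_
      contrapose! hx
      simp only [Function.mem_support, not_not] at hx ⊢
      simp [pdS, hx]
  · simpa [pdS] using aux_opnorm (fderiv ℝ T x)

theorem aux_grad {d : ℕ} (u : (Fin d → ℝ) → (Fin d → ℝ)) (hT : ContDiff ℝ 1 u)
    (hc : HasCompactSupport u) :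
    eLpNorm (fderiv ℝ u) 2 volume ≤ ENNReal.ofReal ((d : ℝ) ^ (1 / 2 : ℝ) * gradNorm u) := by
  have hcont := hT.continuous_fderiv one_ne_zero
  refine aux_L2 _ (fun x => ∑ i, ∑ j, (pd u x j i) ^ 2) d (by positivity)
    (fun x => by positivity) ?_ fun x => ?_
  · apply Continuous.integrable_of_hasCompactSupport
    · unfold pd; fun_prop
    · refine (hc.fderiv ℝ).mono fun x hx => ?_
      contrapose! hx
      simp only [Function.mem_support, not_not] at hx ⊢
      simp [pd, hx]
  · refine (aux_opnorm (fderiv ℝ u x)).trans ?_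
    rw [Finset.sum_comm]
    gcongr with j
    set v := fderiv ℝ u x (Pi.single j 1) with hv
    have h0 : 0 ≤ ∑ i, (v i) ^ 2 := by positivity
    have : ‖v‖ ≤ √(∑ i, (v i) ^ 2) := by
      refine (pi_norm_le_iff_of_nonneg (by positivity)).2 fun i => ?_
      apply Real.le_sqrt_of_sq_le
      rw [Real.norm_eq_abs, sq_abs]
      exact Finset.single_le_sum (f := fun i => (v i) ^ 2) (fun i _ => sq_nonneg _)
        (Finset.mem_univ i)
    calc ‖v‖ ^ 2 ≤ (√(∑ i, (v i) ^ 2)) ^ 2 := by gcongr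
      _ = ∑ i, (v i) ^ 2 := Real.sq_sqrt h0

theorem aux_convS {d : ℕ} (u : (Fin d → ℝ) → (Fin d → ℝ)) (T : (Fin d → ℝ) → ℝ)
    (x : Fin d → ℝ) : convS u T x = fderiv ℝ T x (u x) := by
  unfold convS pdS
  conv_rhs => rw [pi_eq_sum_univ' (u x)]
  simp [map_sum, map_smul, Pi.single_apply, funext_iff, Pi.single, Function.update_apply,
        eq_comm]

theorem aux_holder {d : ℕ} (u : (Fin d → ℝ) → (Fin d → ℝ)) (T S : (Fin d → ℝ) → ℝ)
    (hu : ContDiff ℝ 1 u) (hT : ContDiff ℝ 1 T) (hS : ContDiff ℝ 1 S) :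
    ENNReal.ofReal |∫ x, convS u T x * S x| ≤
      eLpNorm (fderiv ℝ T) 2 volume * (eLpNorm u 4 volume * eLpNorm S 4 volume) := by
  have hcont := hT.continuous_fderiv one_ne_zero
  have huc := hu.continuous
  have hSc := hS.continuous
  haveI : ENNReal.HolderTriple 4 4 2 := ⟨by
    rw [← two_mul, show (4 : ENNReal) = 2 * 2 by norm_num,
      ENNReal.mul_inv (by simp) (by simp), ← mul_assoc, ENNReal.mul_inv_cancel (by simp) (by simp),
      one_mul]⟩
  have h1 : eLpNorm (fun x => ‖u x‖ * ‖S x‖) 2 volume ≤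
      eLpNorm u 4 volume * eLpNorm S 4 volume := by
    have := eLpNorm_smul_le_mul_eLpNorm (p := 4) (q := 4) (r := 2) (μ := volume)
      (φ := fun x => ‖u x‖) (f := fun x => ‖S x‖) hSc.norm.aestronglyMeasurable
      huc.norm.aestronglyMeasurable
    rw [eLpNorm_norm, eLpNorm_norm] at this
    exact this
  have h2 : eLpNorm (fun x => ‖fderiv ℝ T x‖ * (‖u x‖ * ‖S x‖)) 1 volume ≤
      eLpNorm (fderiv ℝ T) 2 volume * eLpNorm (fun x => ‖u x‖ * ‖S x‖) 2 volume := by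
    have := eLpNorm_smul_le_mul_eLpNorm (p := 2) (q := 2) (r := 1) (μ := volume)
      (φ := fun x => ‖fderiv ℝ T x‖) (f := fun x => ‖u x‖ * ‖S x‖)
      (huc.norm.mul hSc.norm).aestronglyMeasurable
      hcont.norm.aestronglyMeasurable
    rw [eLpNorm_norm] at this
    exact this
  calc ENNReal.ofReal |∫ x, convS u T x * S x| = ‖∫ x, convS u T x * S x‖ₑ := by
        rw [← Real.norm_eq_abs, ofReal_norm_eq_enorm]
    _ ≤ ∫⁻ x, ‖convS u T x * S x‖ₑ := enorm_integral_le_lintegral_enorm _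
    _ = eLpNorm (fun x => convS u T x * S x) 1 volume := by
        rw [eLpNorm_one_eq_lintegral_enorm]
    _ ≤ eLpNorm (fun x => ‖fderiv ℝ T x‖ * (‖u x‖ * ‖S x‖)) 1 volume := by
        refine eLpNorm_mono_real fun x => ?_
        rw [aux_convS, norm_mul, ← mul_assoc]
        gcongr
        exact (fderiv ℝ T x).le_opNorm _
    _ ≤ _ := h2
    _ ≤ _ := by gcongr

theorem gradNorm_nn {d : ℕ} (u : (Fin d → ℝ) → (Fin d → ℝ)) : 0 ≤ gradNorm u :=
  Real.rpow_nonneg (integral_nonneg fun x => by positivity) _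

theorem gradNormS_nn {d : ℕ} (u : (Fin d → ℝ) → ℝ) : 0 ≤ gradNormS u :=
  Real.rpow_nonneg (integral_nonneg fun x => by positivity) _

/-- For `d ∈ {2,3}` and a bounded open `Ω ⊂ ℝ^d`, there is `C₃ = C₃(Ω)`
such that for every C¹ vector field `u` and C¹ scalars `T, S`, all with compact
support in `Ω`, `|b*(u,T,S)| ≤ C₃ ‖∇u‖ ‖∇T‖ ‖∇S‖`. -/
theorem statement4 {d : ℕ} (hd : d = 2 ∨ d = 3)
    (Ω : Set (Fin d → ℝ)) (hΩo : IsOpen Ω) (hΩb : Bornology.IsBounded Ω) :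
    ∃ C₃ : ℝ, ∀ (u : (Fin d → ℝ) → (Fin d → ℝ)) (T S : (Fin d → ℝ) → ℝ),
      ContDiff ℝ 1 u → ContDiff ℝ 1 T → ContDiff ℝ 1 S →
      HasCompactSupport u → HasCompactSupport T → HasCompactSupport S →
      tsupport u ⊆ Ω → tsupport T ⊆ Ω → tsupport S ⊆ Ω →
      |bstar u T S| ≤ C₃ * gradNorm u * gradNormS T * gradNormS S := by
  obtain ⟨A, hA⟩ := aux_L4 hd Ω hΩb (Fin d → ℝ)
  obtain ⟨B, hB⟩ := aux_L4 hd Ω hΩb ℝ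
  set D : ℝ := (d : ℝ) ^ (1 / 2 : ℝ) with hD
  have hD0 : 0 ≤ D := by positivity
  have key : ∀ (u : (Fin d → ℝ) → (Fin d → ℝ)) (T S : (Fin d → ℝ) → ℝ),
      ContDiff ℝ 1 u → ContDiff ℝ 1 T → ContDiff ℝ 1 S →
      HasCompactSupport u → HasCompactSupport T → HasCompactSupport S →
      tsupport u ⊆ Ω → tsupport T ⊆ Ω → tsupport S ⊆ Ω →
      |∫ x, convS u T x * S x| ≤ (D * gradNormS T) *
        ((A * (D * gradNorm u)) * (B * (D * gradNormS S))) := by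
    intro u T S hu hT hS cu cT cS su sT sS
    have gu := gradNorm_nn u
    have gT := gradNormS_nn T
    have gS := gradNormS_nn S
    rw [← ENNReal.ofReal_le_ofReal_iff (by positivity)]
    refine (aux_holder u T S hu hT hS).trans ?_
    rw [ENNReal.ofReal_mul (by positivity), ENNReal.ofReal_mul (p := _ * _) (by positivity),
      ENNReal.ofReal_mul (p := (A : ℝ)) (by positivity),
      ENNReal.ofReal_mul (p := (B : ℝ)) (by positivity),
      ENNReal.ofReal_coe_nnreal, ENNReal.ofReal_coe_nnreal]
    gcongr
    · exact aux_gradS T hT cT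
    · refine (hA u hu su).trans ?_
      gcongr
      exact aux_grad u hu cu
    · refine (hB S hS sS).trans ?_
      gcongr
      exact aux_gradS S hS cS
  refine ⟨D * A * D * B * D, fun u T S hu hT hS cu cT cS su sT sS => ?_⟩
  have k1 := key u T S hu hT hS cu cT cS su sT sS
  have k2 := key u S T hu hS hT cu cS cT su sS sT
  unfold bstar
  rw [abs_le] at k1 k2 ⊢
  constructor <;> linarith [k1.1, k1.2, k2.1, k2.2]
end
end

section
/- Let Ω ⊂ ℝ³ be a bounded open set. There exists a constant C = C(Ω) such that for all continuously differentiable vector fields u, v, w : ℝ³ → ℝ³ with compact support contained in Ω, the (non-symmetrized) convective term satisfies |(u·∇v, w)| ≤ C ‖∇u‖ ‖∇v‖ √(‖w‖ ‖∇w‖), where (·,·) is the L² inner product. -/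
open MeasureTheory

noncomputable section

open scoped ENNReal NNReal

lemma aux_l2 {F : Type*} [NormedAddCommGroup F] {f : (Fin 3 → ℝ) → F} {g : (Fin 3 → ℝ) → ℝ}
    (hg : Integrable g) (h : ∀ x, ‖f x‖ ^ 2 ≤ g x) :
    eLpNorm f 2 volume ≤ ENNReal.ofReal ((∫ x, g x) ^ (1 / 2 : ℝ)) := by
  have h0 : ∀ x, 0 ≤ g x := fun x => le_trans (by positivity) (h x)
  have := eLpNorm_nnreal_eq_lintegral (f := f) (μ := volume) (p := 2) (by norm_num)
  simp only [ENNReal.coe_ofNat, NNReal.coe_ofNat] at this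
  rw [this, ← ENNReal.ofReal_rpow_of_nonneg (integral_nonneg h0) (by norm_num)]
  gcongr
  rw [ofReal_integral_eq_lintegral_ofReal hg (Filter.Eventually.of_forall h0)]
  gcongr with x
  rw [← ofReal_norm, ENNReal.ofReal_rpow_of_nonneg (norm_nonneg _) (by norm_num)]
  apply ENNReal.ofReal_le_ofReal
  simpa using h x

lemma abs_pd_le (v : (Fin 3 → ℝ) → (Fin 3 → ℝ)) (x : Fin 3 → ℝ) (j i : Fin 3) :
    |pd v x j i| ≤ ‖fderiv ℝ v x‖ := by
  have h1 := norm_le_pi_norm (fderiv ℝ v x (Pi.single j (1 : ℝ))) i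
  have h2 := (fderiv ℝ v x).le_opNorm (Pi.single j (1 : ℝ))
  have h3 : ‖(Pi.single j (1 : ℝ) : Fin 3 → ℝ)‖ = 1 := by simp [Pi.norm_single]
  rw [h3, mul_one] at h2
  exact h1.trans h2

lemma norm_fderiv_sq_le (v : (Fin 3 → ℝ) → (Fin 3 → ℝ)) (x : Fin 3 → ℝ) :
    ‖fderiv ℝ v x‖ ^ 2 ≤ 4 * ∑ i, ∑ j, (pd v x j i) ^ 2 := by
  set S := ∑ i, ∑ j, (pd v x j i) ^ 2 with hS
  have hS0 : 0 ≤ S := by positivity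
  have key : ‖fderiv ℝ v x‖ ≤ Real.sqrt (4 * S) := by
    refine ContinuousLinearMap.opNorm_le_bound _ (Real.sqrt_nonneg _) fun y => ?_
    refine (pi_norm_le_iff_of_nonneg (by positivity)).2 fun i => ?_
    have hy : y = ∑ j, y j • (Pi.single j (1 : ℝ) : Fin 3 → ℝ) := by
      ext k; simp [Finset.sum_apply, Pi.single_apply]
    have e : fderiv ℝ v x y i = ∑ j, y j * pd v x j i := by
      conv_lhs => rw [hy]
      simp [map_sum, Finset.sum_apply, pd]
    rw [e, Real.norm_eq_abs]
    have h1 : |∑ j, y j * pd v x j i| ≤ ‖y‖ * ∑ j, |pd v x j i| := by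
      refine (Finset.abs_sum_le_sum_abs _ _).trans ?_
      rw [Finset.mul_sum]
      gcongr with j
      rw [abs_mul]
      gcongr
      exact norm_le_pi_norm y j
    have h2 : ∑ j, |pd v x j i| ≤ Real.sqrt (4 * S) := by
      apply Real.le_sqrt_of_sq_le
      have h3 : ∑ j, (pd v x j i) ^ 2 ≤ S :=
        Finset.single_le_sum (f := fun i => ∑ j, (pd v x j i) ^ 2)
          (fun _ _ => by positivity) (Finset.mem_univ i)
      have h4 := sq_sum_le_card_mul_sum_sq (s := Finset.univ) (f := fun j => |pd v x j i|)
      simp only [sq_abs, Finset.card_univ, Fintype.card_fin, Nat.cast_ofNat] at h4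
      linarith
    calc _ ≤ _ := h1
      _ ≤ ‖y‖ * Real.sqrt (4 * S) := by gcongr
      _ = _ := mul_comm _ _
  calc _ ≤ Real.sqrt (4 * S) ^ 2 := by gcongr
    _ = _ := Real.sq_sqrt (by positivity)

lemma eLpNorm_fderiv_le {v : (Fin 3 → ℝ) → (Fin 3 → ℝ)} (hv : ContDiff ℝ 1 v)
    (hc : HasCompactSupport v) :
    eLpNorm (fderiv ℝ v) 2 volume ≤ ENNReal.ofReal (2 * gradNorm v) := by
  have hcd : Continuous (fderiv ℝ v) := hv.continuous_fderiv one_ne_zero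
  have hI : Integrable (fun x => 4 * ∑ i, ∑ j, (pd v x j i) ^ 2) := by
    refine Continuous.integrable_of_hasCompactSupport ?_ ?_
    · unfold pd; fun_prop
    · refine (hc.fderiv (𝕜 := ℝ)).mono' ?_
      refine Function.support_subset_iff'.2 fun x hx => ?_
      have : fderiv ℝ v x = 0 := image_eq_zero_of_notMem_tsupport hx
      simp [pd, this]
  refine (aux_l2 hI (norm_fderiv_sq_le v)).trans (le_of_eq ?_)
  congr 1
  rw [integral_const_mul, Real.mul_rpow (by norm_num) (integral_nonneg fun x => by positivity),
    gradNorm]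
  congr 1
  rw [← Real.sqrt_eq_rpow, show (4 : ℝ) = 2 ^ 2 by norm_num, Real.sqrt_sq (by norm_num)]

lemma eLpNorm_two_le {w : (Fin 3 → ℝ) → (Fin 3 → ℝ)} (hw : ContDiff ℝ 1 w)
    (hc : HasCompactSupport w) :
    eLpNorm w 2 volume ≤ ENNReal.ofReal (l2norm w) := by
  have hcw := hw.continuous
  have hI : Integrable (fun x => ∑ i, (w x i) ^ 2) := by
    refine Continuous.integrable_of_hasCompactSupport (by fun_prop) ?_
    refine hc.mono ?_
    refine Function.support_subset_iff'.2 fun x hx => ?_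
    have : w x = 0 := by simpa using hx
    simp [this]
  refine aux_l2 hI fun x => ?_
  have : ‖w x‖ ≤ Real.sqrt (∑ i, (w x i) ^ 2) := by
    refine (pi_norm_le_iff_of_nonneg (by positivity)).2 fun i => ?_
    refine Real.abs_le_sqrt ?_
    exact Finset.single_le_sum (f := fun i => (w x i) ^ 2)
          (fun _ _ => by positivity) (Finset.mem_univ i)
  calc _ ≤ Real.sqrt (∑ i, (w x i) ^ 2) ^ 2 := by gcongr
    _ = _ := Real.sq_sqrt (by positivity)

lemma sobolev6 {v : (Fin 3 → ℝ) → (Fin 3 → ℝ)} (hv : ContDiff ℝ 1 v)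
    (hc : HasCompactSupport v) :
    eLpNorm v 6 volume ≤
      (SNormLESNormFDerivOfEqConst (Fin 3 → ℝ) (volume : Measure (Fin 3 → ℝ)) 2 : ℝ≥0) *
        ENNReal.ofReal (2 * gradNorm v) := by
  have h := eLpNorm_le_eLpNorm_fderiv_of_eq (volume : Measure (Fin 3 → ℝ)) hv hc
    (p := 2) (p' := 6) (by norm_num) (by simp) (by simp; norm_num)
  simp only [ENNReal.coe_ofNat, NNReal.coe_ofNat] at h
  refine h.trans ?_
  gcongr
  exact eLpNorm_fderiv_le hv hc

lemma holder4 {f1 f2 f3 : (Fin 3 → ℝ) → ℝ≥0∞} (h1 : AEMeasurable f1) (h2 : AEMeasurable f2)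
    (h3 : AEMeasurable f3) :
    ∫⁻ x, f1 x * f2 x * f3 x ≤
      (∫⁻ x, f1 x ^ (6 : ℝ)) ^ (1 / 6 : ℝ) * (∫⁻ x, f2 x ^ (2 : ℝ)) ^ (1 / 2 : ℝ) *
      ((∫⁻ x, f3 x ^ (2 : ℝ)) ^ (1 / 2 : ℝ)) ^ (1 / 2 : ℝ) *
      ((∫⁻ x, f3 x ^ (6 : ℝ)) ^ (1 / 6 : ℝ)) ^ (1 / 2 : ℝ) := by
  have h := ENNReal.lintegral_prod_norm_pow_le (μ := (volume : Measure (Fin 3 → ℝ)))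
    (Finset.univ : Finset (Fin 4))
    (f := ![fun x => f1 x ^ (6 : ℝ), fun x => f2 x ^ (2 : ℝ), fun x => f3 x ^ (2 : ℝ),
      fun x => f3 x ^ (6 : ℝ)])
    (by intro i _; fin_cases i <;> simp <;> fun_prop)
    (p := ![1/6, 1/2, 1/4, 1/12])
    (by simp [Fin.sum_univ_four]; norm_num)
    (by intro i _; fin_cases i <;> simp)
  simp only [Fin.prod_univ_four, Matrix.cons_val] at h
  simp only [← ENNReal.rpow_mul] at h ⊢
  norm_num at h ⊢
  refine le_trans (le_of_eq ?_) h
  refine lintegral_congr fun x => ?_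
  rw [mul_assoc (f1 x * f2 x), ← ENNReal.rpow_add_of_nonneg _ _ (by norm_num) (by norm_num)]
  norm_num

lemma pointwise (u v w : (Fin 3 → ℝ) → (Fin 3 → ℝ)) (x : Fin 3 → ℝ) :
    |dotv (conv u v x) (w x)| ≤ 9 * (‖u x‖ * ‖fderiv ℝ v x‖ * ‖w x‖) := by
  unfold dotv conv
  calc _ ≤ ∑ i : Fin 3, ∑ j : Fin 3, ‖u x‖ * ‖fderiv ℝ v x‖ * ‖w x‖ := by
        refine (Finset.abs_sum_le_sum_abs _ _).trans ?_
        gcongr with i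
        rw [abs_mul, ← Finset.sum_mul]
        gcongr
        · refine (Finset.abs_sum_le_sum_abs _ _).trans ?_
          gcongr with j
          rw [abs_mul]
          gcongr
          · exact norm_le_pi_norm (u x) j
          · exact abs_pd_le v x j i
        · exact norm_le_pi_norm (w x) i
    _ = _ := by simp; ring

/-- For a bounded open `Ω ⊂ ℝ³`, there is `C = C(Ω)` such that for all
C¹ vector fields `u, v, w : ℝ³ → ℝ³` with compact support in `Ω`, the convective term
satisfies `|(u·∇v, w)| ≤ C ‖∇u‖ ‖∇v‖ √(‖w‖ ‖∇w‖)`. -/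
theorem statement8 (Ω : Set (Fin 3 → ℝ)) (hΩo : IsOpen Ω) (hΩb : Bornology.IsBounded Ω) :
    ∃ C : ℝ, ∀ u v w : (Fin 3 → ℝ) → (Fin 3 → ℝ),
      ContDiff ℝ 1 u → ContDiff ℝ 1 v → ContDiff ℝ 1 w →
      HasCompactSupport u → HasCompactSupport v → HasCompactSupport w →
      tsupport u ⊆ Ω → tsupport v ⊆ Ω → tsupport w ⊆ Ω →
      |∫ x, dotv (conv u v x) (w x)|
        ≤ C * gradNorm u * gradNorm v * Real.sqrt (l2norm w * gradNorm w) := by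
  set K : ℝ≥0 := SNormLESNormFDerivOfEqConst (Fin 3 → ℝ) (volume : Measure (Fin 3 → ℝ)) 2
  refine ⟨9 * (K * 2) * 2 * Real.sqrt (K * 2), ?_⟩
  intro u v w hu hv hw hcu hcv hcw _ _ _
  have gn : ∀ f : (Fin 3 → ℝ) → (Fin 3 → ℝ), 0 ≤ gradNorm f := fun f =>
    Real.rpow_nonneg (integral_nonneg fun x => by positivity) _
  have ln : ∀ f : (Fin 3 → ℝ) → (Fin 3 → ℝ), 0 ≤ l2norm f := fun f =>
    Real.rpow_nonneg (integral_nonneg fun x => by positivity) _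
  have gu := gn u
  have gv := gn v
  have gw := gn w
  have lw := ln w
  have hfv : Continuous (fderiv ℝ v) := hv.continuous_fderiv one_ne_zero
  have huc := hu.continuous
  have hwc := hw.continuous
  have e6 : ∀ f : (Fin 3 → ℝ) → (Fin 3 → ℝ), eLpNorm f 6 volume =
      (∫⁻ x, ‖f x‖ₑ ^ (6 : ℝ)) ^ (1 / 6 : ℝ) := fun f => by
    simpa using eLpNorm_nnreal_eq_lintegral (f := f) (μ := volume) (p := 6) (by norm_num)
  have e2 : eLpNorm w 2 volume = (∫⁻ x, ‖w x‖ₑ ^ (2 : ℝ)) ^ (1 / 2 : ℝ) := by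
    simpa using eLpNorm_nnreal_eq_lintegral (f := w) (μ := volume) (p := 2) (by norm_num)
  have e2' : eLpNorm (fderiv ℝ v) 2 volume =
      (∫⁻ x, ‖fderiv ℝ v x‖ₑ ^ (2 : ℝ)) ^ (1 / 2 : ℝ) := by
    simpa using
      eLpNorm_nnreal_eq_lintegral (f := fderiv ℝ v) (μ := volume) (p := 2) (by norm_num)
  have H := holder4 (f1 := fun x => ‖u x‖ₑ) (f2 := fun x => ‖fderiv ℝ v x‖ₑ)
    (f3 := fun x => ‖w x‖ₑ) (by fun_prop) (by fun_prop) (by fun_prop)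
  rw [← e6, ← e6, ← e2, ← e2'] at H
  have KO : (K : ℝ≥0∞) = ENNReal.ofReal K := by simp
  have su := sobolev6 hu hcu
  have sw := sobolev6 hw hcw
  change _ ≤ (K : ℝ≥0∞) * _ at su
  change _ ≤ (K : ℝ≥0∞) * _ at sw
  rw [KO, ← ENNReal.ofReal_mul (by positivity)] at su sw
  have main : ENNReal.ofReal |∫ x, dotv (conv u v x) (w x)| ≤
      ENNReal.ofReal (9 * ((K * (2 * gradNorm u)) * (2 * gradNorm v) *
        (l2norm w) ^ (1 / 2 : ℝ) * (K * (2 * gradNorm w)) ^ (1 / 2 : ℝ))) := by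
    calc ENNReal.ofReal |∫ x, dotv (conv u v x) (w x)|
        = ‖∫ x, dotv (conv u v x) (w x)‖ₑ := by
          rw [← ofReal_norm, Real.norm_eq_abs]
      _ ≤ ∫⁻ x, ‖dotv (conv u v x) (w x)‖ₑ := enorm_integral_le_lintegral_enorm _
      _ ≤ ∫⁻ x, 9 * (‖u x‖ₑ * ‖fderiv ℝ v x‖ₑ * ‖w x‖ₑ) := by
          gcongr with x
          have := ENNReal.ofReal_le_ofReal (pointwise u v w x)
          rw [ENNReal.ofReal_mul (by norm_num), ENNReal.ofReal_mul (by positivity),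
            ENNReal.ofReal_mul (by positivity), ← Real.norm_eq_abs] at this
          rw [ofReal_norm, ofReal_norm, ofReal_norm, ofReal_norm] at this
          simpa only [ENNReal.ofReal_ofNat] using this
      _ = 9 * ∫⁻ x, ‖u x‖ₑ * ‖fderiv ℝ v x‖ₑ * ‖w x‖ₑ := by
          rw [lintegral_const_mul' _ _ (by simp)]
      _ ≤ 9 * (ENNReal.ofReal (K * (2 * gradNorm u)) * ENNReal.ofReal (2 * gradNorm v) *
            ENNReal.ofReal (l2norm w) ^ (1 / 2 : ℝ) *
            ENNReal.ofReal (K * (2 * gradNorm w)) ^ (1 / 2 : ℝ)) := by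
          gcongr
          refine H.trans ?_
          gcongr
          · exact eLpNorm_fderiv_le hv hcv
          · exact eLpNorm_two_le hw hcw
      _ = _ := by
          rw [ENNReal.ofReal_rpow_of_nonneg lw (by norm_num),
            ENNReal.ofReal_rpow_of_nonneg (by positivity) (by norm_num),
            ← ENNReal.ofReal_mul (by positivity), ← ENNReal.ofReal_mul (by positivity),
            ← ENNReal.ofReal_mul (by positivity), ENNReal.ofReal_mul (p := 9) (by norm_num),
            ENNReal.ofReal_ofNat]
  rw [ENNReal.ofReal_le_ofReal_iff (by positivity)] at main
  refine main.trans (le_of_eq ?_)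
  rw [← Real.sqrt_eq_rpow, ← Real.sqrt_eq_rpow, Real.sqrt_mul lw, ← mul_assoc (K : ℝ) 2 (gradNorm w),
    Real.sqrt_mul (by positivity)]
  ring
end
end
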